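/- arXiv:2508.21594 — 2 statements merged into one kernel-verified Lean document; each statement's English description precedes it below -/
import Mathlib

section
/- (Type I error control of the quantum sequential universal test, finite-horizon form.) Fix an adaptive measurement scheme with horizon t, disjoint sets S₀ and S₁ of density matrices on ℂ^d, and assume Tr(ρ^{⊗n_i} M^i(h)_x) > 0 for every ρ ∈ S₀ ∪ S₁, round i, history h, and outcome x. Let null MLE maps ρ̂₀^s and alternative MLE maps ρ̂₁^s be given for all 0 ≤ s ≤ t, and let Λ₀^s be the associated split likelihood ratio. Then for every target type I error ε₀ ∈ (0,1) and every ρ ∈ S₀, the probability that the split likelihood ratio ever crosses the threshold 1/ε₀ is at most ε₀: ∑_{x ∈ X^t : ∃ s ≤ t, Λ₀^s(x) ≥ 1/ε₀} P_ρ(x) ≤ ε₀. -/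
open Matrix BigOperators
open scoped ComplexOrder

noncomputable section

/-- A density matrix on `ℂ^d`: positive semidefinite with trace 1. -/
def IsDensityMatrix {d : ℕ} (ρ : Matrix (Fin d) (Fin d) ℂ) : Prop :=
  ρ.PosSemidef ∧ ρ.trace = 1

/-- A POVM with finite outcome set `X`: positive semidefinite effects summing to the identity. -/
def IsPOVM {m : Type*} [Fintype m] [DecidableEq m] {X : Type*} [Fintype X]
    (M : X → Matrix m m ℂ) : Prop :=
  (∀ x, (M x).PosSemidef) ∧ ∑ x, M x = 1

/-- The `n`-fold tensor power of a `d × d` matrix, indexed by tuples in `Fin n → Fin d`,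
with entries `(ρ^{⊗n})_{x,y} = ∏ i, ρ (x i) (y i)`. -/
def tensorPow {d : ℕ} (ρ : Matrix (Fin d) (Fin d) ℂ) (n : ℕ) :
    Matrix (Fin n → Fin d) (Fin n → Fin d) ℂ :=
  fun x y => ∏ i, ρ (x i) (y i)

/-- Born probability `Tr(ρ M)` as the associated (nonnegative) real number. -/
def bornProb {m : Type*} [Fintype m] (ρ M : Matrix m m ℂ) : ℝ :=
  ((ρ * M).trace).re

/-- An adaptive measurement scheme with horizon `t`: at round `i` (0-based), given a
history `h ∈ X^i`, it measures `n i ≥ 1` fresh copies with the POVM `M i h`. -/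
structure AdaptiveScheme (d : ℕ) (X : Type*) [Fintype X] (t : ℕ) where
  n : Fin t → ℕ
  hn : ∀ i, 1 ≤ n i
  M : (i : Fin t) → (Fin i → X) → X →
        Matrix (Fin (n i) → Fin d) (Fin (n i) → Fin d) ℂ
  hM : ∀ i h, IsPOVM (M i h)

/-- The history (first `i` outcomes) of an outcome sequence `x`. -/
def hist {X : Type*} {t : ℕ} (x : Fin t → X) (i : Fin t) : Fin i → X :=
  fun j => x ⟨j, j.isLt.trans i.isLt⟩

/-- Probability of observing the outcome sequence `x` under state `ρ`. -/
def seqProb {d t : ℕ} {X : Type*} [Fintype X] (S : AdaptiveScheme d X t)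
    (ρ : Matrix (Fin d) (Fin d) ℂ) (x : Fin t → X) : ℝ :=
  ∏ i, bornProb (tensorPow ρ (S.n i)) (S.M i (hist x i) (x i))

/-- Likelihood of the first `s` outcomes of a history `h ∈ X^s` under state `ρ`:
`∏_{i=1}^{s} Tr(ρ^{⊗ n_i} M^i(h_1,…,h_{i-1})_{h_i})` (rounds beyond the horizon contribute 1). -/
def likOnHist {d t : ℕ} {X : Type*} [Fintype X] (S : AdaptiveScheme d X t)
    (ρ : Matrix (Fin d) (Fin d) ℂ) (s : ℕ) (h : Fin s → X) : ℝ :=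
  ∏ i : Fin t, if hi : (i : ℕ) < s then
    bornProb (tensorPow ρ (S.n i))
      (S.M i (fun j => h ⟨j, j.isLt.trans hi⟩) (h ⟨i, hi⟩))
  else 1

/-- An MLE map for the class `S₀`: at each time `s ≤ t` and history `h ∈ X^s`, it returns a
state of `S₀` maximizing the likelihood of `h` over `S₀`. -/
def IsMLEMap {d t : ℕ} {X : Type*} [Fintype X] (S : AdaptiveScheme d X t)
    (S₀ : Set (Matrix (Fin d) (Fin d) ℂ))
    (est : (s : ℕ) → (Fin s → X) → Matrix (Fin d) (Fin d) ℂ) : Prop :=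
  ∀ s : ℕ, s ≤ t → ∀ h : Fin s → X,
    est s h ∈ S₀ ∧ ∀ ρ' ∈ S₀, likOnHist S ρ' s h ≤ likOnHist S (est s h) s h

/-- The split likelihood ratio at time `s ≤ t`:
`Λ₀^s(x) = ∏_{i=1}^{s} Tr((ρ̂₁^{i-1}(x_{<i}))^{⊗n_i} M^i_{x_i}) / Tr((ρ̂₀^{s}(x_{≤s}))^{⊗n_i} M^i_{x_i})`,
with non-anticipating alternative MLEs in the numerator and the time-`s` null MLE in the
denominator. -/
def slr₀ {d t : ℕ} {X : Type*} [Fintype X] (S : AdaptiveScheme d X t)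
    (est₀ est₁ : (s : ℕ) → (Fin s → X) → Matrix (Fin d) (Fin d) ℂ)
    (x : Fin t → X) (s : ℕ) (hs : s ≤ t) : ℝ :=
  ∏ i : Fin t, if (i : ℕ) < s then
    bornProb (tensorPow (est₁ i (hist x i)) (S.n i)) (S.M i (hist x i) (x i)) /
      bornProb (tensorPow (est₀ s (fun j => x (Fin.castLE hs j))) (S.n i))
        (S.M i (hist x i) (x i))
  else 1

/-- The reversed split likelihood ratio at time `s ≤ t`, exchanging the roles of the null and
alternative hypotheses:
`Λ₁^s(x) = ∏_{i=1}^{s} Tr((ρ̂₀^{i-1}(x_{<i}))^{⊗n_i} M^i_{x_i}) / Tr((ρ̂₁^{s}(x_{≤s}))^{⊗n_i} M^i_{x_i})`. -/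
def slr₁ {d t : ℕ} {X : Type*} [Fintype X] (S : AdaptiveScheme d X t)
    (est₀ est₁ : (s : ℕ) → (Fin s → X) → Matrix (Fin d) (Fin d) ℂ)
    (x : Fin t → X) (s : ℕ) (hs : s ≤ t) : ℝ :=
  ∏ i : Fin t, if (i : ℕ) < s then
    bornProb (tensorPow (est₀ i (hist x i)) (S.n i)) (S.M i (hist x i) (x i)) /
      bornProb (tensorPow (est₁ s (fun j => x (Fin.castLE hs j))) (S.n i))
        (S.M i (hist x i) (x i))
  else 1

theorem trace_tensorPow {d : ℕ} (ρ : Matrix (Fin d) (Fin d) ℂ) (n : ℕ) :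
    (tensorPow ρ n).trace = ρ.trace ^ n := by
  simp only [Matrix.trace, Matrix.diag, tensorPow]
  exact (Fintype.sum_pow (fun k => ρ k k) n).symm

theorem IsPOVM.sum_bornProb {m : Type*} [Fintype m] [DecidableEq m] {X : Type*} [Fintype X]
    {M : X → Matrix m m ℂ} (hM : IsPOVM M) (ρ : Matrix m m ℂ) :
    ∑ x, bornProb ρ (M x) = ρ.trace.re := by
  simp only [bornProb]
  rw [← Complex.re_sum, ← Matrix.trace_sum, ← Matrix.mul_sum, hM.2, mul_one]

theorem hist_cons_succ {X : Type*} {t : ℕ} (a : X) (x : Fin t → X) (i : Fin t) :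
    hist (Fin.cons a x : Fin (t + 1) → X) i.succ =
      (Fin.cons a (hist x i) : Fin ((i : ℕ) + 1) → X) := by
  funext j
  exact Fin.cases rfl (fun _ => rfl) j

theorem sum_fin_cons {X : Type*} [Fintype X] {t : ℕ} (f : (Fin (t + 1) → X) → ℝ) :
    ∑ x, f x = ∑ a, ∑ x : Fin t → X, f (Fin.cons a x : Fin (t + 1) → X) := by
  rw [← Fintype.sum_prod_type']
  exact ((Fin.consEquiv fun _ => X).sum_comp f).symm

/-- A product of conditional probability distributions has total mass 1. -/
theorem sum_prod_hist_eq_one {X : Type*} [Fintype X] {t : ℕ}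
    (p : (i : Fin t) → (Fin i → X) → X → ℝ) (hp : ∀ i h, ∑ a, p i h a = 1) :
    ∑ x : Fin t → X, ∏ i, p i (hist x i) (x i) = 1 := by
  induction t with
  | zero => simp
  | succ t ih =>
    obtain ⟨e, he⟩ : ∃ e : Fin ((0 : Fin (t + 1)) : ℕ) → X, ∀ e', e' = e :=
      ⟨fun j => j.elim0, fun e' => funext fun j => j.elim0⟩
    rw [sum_fin_cons]
    simp only [Fin.prod_univ_succ, hist_cons_succ, Fin.cons_zero, Fin.cons_succ]
    calc ∑ a, ∑ x : Fin t → X, p 0 (hist (Fin.cons a x : Fin (t + 1) → X) 0) a *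
          ∏ i : Fin t, p i.succ (Fin.cons a (hist x i) : Fin ((i : ℕ) + 1) → X) (x i)
        = ∑ a, p 0 e a := by
          refine Finset.sum_congr rfl fun a _ => ?_
          have h0 (x : Fin t → X) :
              hist (Fin.cons a x : Fin (t + 1) → X) 0 = e := he _
          simp only [h0]
          rw [← Finset.mul_sum, ih (fun i h => p i.succ (Fin.cons a h : Fin ((i : ℕ) + 1) → X))
            (fun i h => hp _ _), mul_one]
      _ = 1 := hp 0 _

open Classical in
/-- Ville's maximal inequality for the likelihood ratio process of two adaptive sequences of
conditional distributions on a finite outcome set, started from wealth `w`. -/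
theorem ville_likelihoodRatio {X : Type*} [Fintype X] {t : ℕ}
    (p q : (i : Fin t) → (Fin i → X) → X → ℝ)
    (hp : ∀ i h, ∑ a, p i h a = 1) (hq : ∀ i h, ∑ a, q i h a = 1)
    (hp_pos : ∀ i h a, 0 < p i h a) (hq_nonneg : ∀ i h a, 0 ≤ q i h a)
    {c w : ℝ} (hc : 0 < c) (hw : 0 ≤ w) :
    ∑ x : Fin t → X,
      (if ∃ s ≤ t, c ≤ w * ∏ i : Fin t,
          (if (i : ℕ) < s then q i (hist x i) (x i) / p i (hist x i) (x i) else 1)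
        then ∏ i, p i (hist x i) (x i) else 0) ≤ w / c := by
  induction t generalizing w with
  | zero =>
    simp only [Finset.univ_eq_empty, Finset.prod_empty, mul_one]
    split_ifs with h
    · obtain ⟨s, -, hs⟩ := h
      simpa [one_le_div hc] using hs
    · simpa using div_nonneg hw hc.le
  | succ t ih =>
    by_cases hcw : c ≤ w
    · calc _ ≤ ∑ x : Fin (t + 1) → X, ∏ i, p i (hist x i) (x i) := by
            refine Finset.sum_le_sum fun x _ => ?_
            split_ifs
            · exact le_rfl
            · exact Finset.prod_nonneg fun i _ => (hp_pos _ _ _).le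
        _ = 1 := sum_prod_hist_eq_one p hp
        _ ≤ w / c := (one_le_div hc).2 hcw
    · obtain ⟨e, he⟩ : ∃ e : Fin ((0 : Fin (t + 1)) : ℕ) → X, ∀ e', e' = e :=
        ⟨fun j => j.elim0, fun e' => funext fun j => j.elim0⟩
      rw [sum_fin_cons]
      calc _ ≤ ∑ a, w * q 0 e a / c := by
            refine Finset.sum_le_sum fun a _ => ?_
            have hpa := hp_pos 0 e a
            have h0 (x : Fin t → X) :
                hist (Fin.cons a x : Fin (t + 1) → X) 0 = e := he _
            have key := ih
              (fun i h => p i.succ (Fin.cons a h : Fin ((i : ℕ) + 1) → X))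
              (fun i h => q i.succ (Fin.cons a h : Fin ((i : ℕ) + 1) → X))
              (fun i h => hp _ _) (fun i h => hq _ _)
              (fun i h b => hp_pos _ _ _) (fun i h b => hq_nonneg _ _ _)
              (w := w * (q 0 e a / p 0 e a))
              (mul_nonneg hw (div_nonneg (hq_nonneg _ _ _) hpa.le))
            have hmul := mul_le_mul_of_nonneg_left key hpa.le
            have hrhs : p 0 e a * (w * (q 0 e a / p 0 e a) / c) =
                w * q 0 e a / c := by
              field_simp
            rw [hrhs, Finset.mul_sum] at hmul
            refine le_trans (Finset.sum_le_sum fun x _ => ?_) hmul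
            simp only [Fin.prod_univ_succ, hist_cons_succ, Fin.cons_zero, Fin.cons_succ, h0,
              Fin.val_zero, Fin.val_succ, mul_ite, mul_zero]
            have hnn : 0 ≤ p 0 e a *
                ∏ i : Fin t, p i.succ (Fin.cons a (hist x i) : Fin ((i : ℕ) + 1) → X) (x i) :=
              mul_nonneg hpa.le (Finset.prod_nonneg fun i _ => (hp_pos _ _ _).le)
            split_ifs with hcross hcross'
            · exact le_rfl
            · refine absurd ?_ hcross'
              obtain ⟨s, hs, hle⟩ := hcross
              cases s with
              | zero => exact absurd (by simpa using hle) hcw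
              | succ s =>
                refine ⟨s, by omega, ?_⟩
                simpa [mul_assoc] using hle
            · exact hnn
            · exact le_rfl
        _ = w / c := by
            rw [← Finset.sum_div, ← Finset.mul_sum, hq, mul_one]

theorem likOnHist_castLE {d t : ℕ} {X : Type*} [Fintype X] (S : AdaptiveScheme d X t)
    (ρ : Matrix (Fin d) (Fin d) ℂ) (x : Fin t → X) {s : ℕ} (hs : s ≤ t) :
    likOnHist S ρ s (fun j => x (Fin.castLE hs j)) =
      ∏ i : Fin t, if (i : ℕ) < s then
        bornProb (tensorPow ρ (S.n i)) (S.M i (hist x i) (x i)) else 1 := by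
  refine Finset.prod_congr rfl fun i _ => ?_
  by_cases hi : (i : ℕ) < s
  · simp only [hi, dif_pos, if_pos]
    rfl
  · simp [hi]

theorem prod_ite_div {ι : Type*} [Fintype ι] (P : ι → Prop) [DecidablePred P] (f g : ι → ℝ) :
    (∏ i, if P i then f i / g i else 1) =
      (∏ i, if P i then f i else 1) / ∏ i, if P i then g i else 1 := by
  rw [← Finset.prod_div_distrib]
  refine Finset.prod_congr rfl fun i _ => ?_
  split_ifs <;> simp

open Classical in
/-- type I error control of the quantum sequential universal test
(finite-horizon form): under any null state, the probability that the split likelihood ratio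
ever crosses the threshold `1/ε₀` is at most `ε₀`. -/
theorem qsut_typeI_error_control {d t : ℕ} {X : Type*} [Fintype X]
    (ht : 1 ≤ t) (S : AdaptiveScheme d X t)
    (S₀ S₁ : Set (Matrix (Fin d) (Fin d) ℂ)) (hdisj : Disjoint S₀ S₁)
    (hS₀ : ∀ ρ' ∈ S₀, IsDensityMatrix ρ') (hS₁ : ∀ ρ' ∈ S₁, IsDensityMatrix ρ')
    (est₀ est₁ : (s : ℕ) → (Fin s → X) → Matrix (Fin d) (Fin d) ℂ)
    (h₀ : IsMLEMap S S₀ est₀) (h₁ : IsMLEMap S S₁ est₁)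
    (hpos : ∀ ρ' ∈ S₀ ∪ S₁, ∀ (i : Fin t) (h : Fin i → X) (x : X),
      0 < bornProb (tensorPow ρ' (S.n i)) (S.M i h x))
    (ε₀ : ℝ) (hε₀ : ε₀ ∈ Set.Ioo (0 : ℝ) 1)
    (ρ : Matrix (Fin d) (Fin d) ℂ) (hρ : ρ ∈ S₀) :
    ∑ x : Fin t → X,
      (if ∃ s : ℕ, ∃ hs : s ≤ t, 1 / ε₀ ≤ slr₀ S est₀ est₁ x s hs
        then seqProb S ρ x else 0) ≤ ε₀ := by
  have hsum (σ : Matrix (Fin d) (Fin d) ℂ) (hσ : IsDensityMatrix σ) (i : Fin t)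
      (h : Fin i → X) : ∑ a, bornProb (tensorPow σ (S.n i)) (S.M i h a) = 1 := by
    rw [IsPOVM.sum_bornProb (S.hM i h), trace_tensorPow, hσ.2, one_pow, Complex.one_re]
  have hest (i : Fin t) (h : Fin i → X) : est₁ i h ∈ S₁ := (h₁ i i.isLt.le h).1
  have hville := ville_likelihoodRatio
    (fun i h a => bornProb (tensorPow ρ (S.n i)) (S.M i h a))
    (fun i h a => bornProb (tensorPow (est₁ i h) (S.n i)) (S.M i h a))
    (fun i h => hsum ρ (hS₀ ρ hρ) i h)
    (fun i h => hsum _ (hS₁ _ (hest i h)) i h)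
    (fun i h a => hpos ρ (Or.inl hρ) i h a)
    (fun i h a => (hpos _ (Or.inr (hest i h)) i h a).le)
    (one_div_pos.2 hε₀.1) zero_le_one
  rw [one_div_one_div] at hville
  refine le_trans (Finset.sum_le_sum fun x _ => ?_) hville
  split_ifs with hcross hcross'
  · exact le_rfl
  · refine absurd ?_ hcross'
    obtain ⟨s, hs, hle⟩ := hcross
    refine ⟨s, hs, hle.trans ?_⟩
    rw [one_mul, slr₀, prod_ite_div, prod_ite_div, ← likOnHist_castLE S _ x hs,
      ← likOnHist_castLE S _ x hs]
    refine div_le_div_of_nonneg_left ?_ ?_ ((h₀ s hs _).2 ρ hρ)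
    · refine Finset.prod_nonneg fun i _ => ?_
      split_ifs
      · exact (hpos _ (Or.inr (hest i _)) _ _ _).le
      · exact zero_le_one
    · rw [likOnHist_castLE]
      refine Finset.prod_pos fun i _ => ?_
      split_ifs
      · exact hpos ρ (Or.inl hρ) _ _ _
      · exact zero_lt_one
  · exact Finset.prod_nonneg fun i _ => (hpos ρ (Or.inl hρ) _ _ _).le
  · exact le_rfl
end
end

section
/- (Prequential plug-in likelihood is dominated by the full maximum likelihood.) Fix an adaptive measurement scheme with horizon t, an outcome sequence x ∈ X^t, and a set S of density matrices on ℂ^d. Suppose that for every 0 ≤ s ≤ t there is a state ρ̂^s ∈ S with ∏_{i=1}^s Tr((ρ')^{⊗n_i} M^i(x_1,…,x_{i-1})_{x_i}) ≤ ∏_{i=1}^s Tr((ρ̂^s)^{⊗n_i} M^i(x_1,…,x_{i-1})_{x_i}) for every ρ' ∈ S. Then the non-anticipating plug-in likelihood is bounded by the full maximum likelihood: ∏_{i=1}^t Tr((ρ̂^{i-1})^{⊗n_i} M^i(x_1,…,x_{i-1})_{x_i}) ≤ ∏_{i=1}^t Tr((ρ̂^t)^{⊗n_i} M^i(x_1,…,x_{i-1})_{x_i}).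 -/
open Matrix BigOperators
open scoped ComplexOrder

noncomputable section

/-- Likelihood of the first `s` outcomes of the sequence `x` under state `ρ`. -/
def partialLik {d t : ℕ} {X : Type*} [Fintype X] (S : AdaptiveScheme d X t)
    (x : Fin t → X) (ρ : Matrix (Fin d) (Fin d) ℂ) (s : ℕ) : ℝ :=
  ∏ i : Fin t, if (i : ℕ) < s then
    bornProb (tensorPow ρ (S.n i)) (S.M i (hist x i) (x i))
  else 1

theorem tensorPow_conjTranspose_mul_self {d : ℕ} (B : Matrix (Fin d) (Fin d) ℂ) (n : ℕ) :
    tensorPow (Bᴴ * B) n = (tensorPow B n)ᴴ * tensorPow B n := by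
  ext x y
  simp only [tensorPow, Matrix.mul_apply, Matrix.conjTranspose_apply, star_prod,
    ← Finset.prod_mul_distrib]
  exact Fintype.prod_sum fun i j => star (B j (x i)) * B j (y i)

open scoped MatrixOrder in
theorem Matrix.PosSemidef.exists_eq_conjTranspose_mul_self {m : Type*} [Fintype m]
    {A : Matrix m m ℂ} (hA : A.PosSemidef) : ∃ B : Matrix m m ℂ, A = Bᴴ * B := by
  classical
  exact CStarAlgebra.nonneg_iff_eq_star_mul_self.mp hA.nonneg

theorem Matrix.PosSemidef.tensorPow {d : ℕ} {ρ : Matrix (Fin d) (Fin d) ℂ}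
    (hρ : ρ.PosSemidef) (n : ℕ) : (tensorPow ρ n).PosSemidef := by
  obtain ⟨B, rfl⟩ := hρ.exists_eq_conjTranspose_mul_self
  rw [tensorPow_conjTranspose_mul_self]
  exact Matrix.posSemidef_conjTranspose_mul_self _

theorem bornProb_nonneg {m : Type*} [Fintype m] {ρ M : Matrix m m ℂ}
    (hρ : ρ.PosSemidef) (hM : M.PosSemidef) : 0 ≤ bornProb ρ M := by
  classical
  obtain ⟨B, rfl⟩ := hρ.exists_eq_conjTranspose_mul_self
  have h := (hM.mul_mul_conjTranspose_same B).trace_nonneg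
  rw [bornProb, Matrix.mul_assoc, Matrix.trace_mul_comm]
  exact (Complex.nonneg_iff.mp h).1

theorem Fin.prod_ite_lt_succ {t : ℕ} {R : Type*} [CommMonoid R] (a : Fin t → R) (k : Fin t) :
    ∏ i : Fin t, (if (i : ℕ) < k + 1 then a i else 1) =
      (∏ i : Fin t, if (i : ℕ) < k then a i else 1) * a k := by
  rw [← Fintype.prod_ite_eq k a, ← Finset.prod_mul_distrib]
  refine Finset.prod_congr rfl fun i _ => ?_
  rcases lt_trichotomy i k with h | rfl | h
  · have h' : (i : ℕ) < k := h
    simp [h', h.ne', h'.trans (Nat.lt_succ_self _)]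
  · simp
  · have h' : (k : ℕ) < i := h
    simp [h.ne, h'.not_gt, Nat.not_lt.mpr (Nat.succ_le_of_lt h')]

/-- If `e s` maximizes the partial product of the first `s` factors among `e 0, …, e t`, then the
product of the plug-in factors is at most the product of the factors at `e t`. -/
theorem prod_plugIn_le_prod_of_forall_le {t : ℕ} {α : Type*} (f : α → Fin t → ℝ) (e : ℕ → α)
    (hf : ∀ s ≤ t, ∀ i, 0 ≤ f (e s) i)
    (hmax : ∀ s ≤ t, ∀ r ≤ t, (∏ i : Fin t, if (i : ℕ) < s then f (e r) i else 1) ≤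
      ∏ i : Fin t, if (i : ℕ) < s then f (e s) i else 1) :
    ∏ i : Fin t, f (e i) i ≤ ∏ i : Fin t, f (e t) i := by
  have key : ∀ s ≤ t, (∏ i : Fin t, if (i : ℕ) < s then f (e i) i else 1) ≤
      ∏ i : Fin t, if (i : ℕ) < s then f (e s) i else 1 := by
    intro s
    induction s with
    | zero => simp
    | succ s ih =>
      intro hs
      have h₁ := Fin.prod_ite_lt_succ (fun i => f (e i) i) ⟨s, hs⟩
      have h₂ := Fin.prod_ite_lt_succ (f (e s)) ⟨s, hs⟩
      have hs' : s ≤ t := (Nat.le_succ s).trans hs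
      calc _ = _ := h₁
        _ ≤ _ := mul_le_mul_of_nonneg_right (ih hs') (hf s hs' _)
        _ = _ := h₂.symm
        _ ≤ _ := hmax (s + 1) hs s hs'
  simpa using key t le_rfl

/-- the prequential plug-in likelihood is dominated by the full maximum
likelihood. -/
theorem prequential_le_full_mle {d t : ℕ} {X : Type*} [Fintype X]
    (ht : 1 ≤ t) (S : AdaptiveScheme d X t) (x : Fin t → X)
    (Scl : Set (Matrix (Fin d) (Fin d) ℂ)) (hScl : ∀ ρ' ∈ Scl, IsDensityMatrix ρ')
    (est : ℕ → Matrix (Fin d) (Fin d) ℂ)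
    (hest : ∀ s : ℕ, s ≤ t → est s ∈ Scl ∧
      ∀ ρ' ∈ Scl, partialLik S x ρ' s ≤ partialLik S x (est s) s) :
    ∏ i : Fin t, bornProb (tensorPow (est i) (S.n i)) (S.M i (hist x i) (x i)) ≤
      ∏ i : Fin t, bornProb (tensorPow (est t) (S.n i)) (S.M i (hist x i) (x i)) := by
  refine prod_plugIn_le_prod_of_forall_le
    (fun ρ i => bornProb (tensorPow ρ (S.n i)) (S.M i (hist x i) (x i))) est ?_ ?_
  · intro s hs i
    exact bornProb_nonneg ((hScl _ (hest s hs).1).1.tensorPow _) ((S.hM i _).1 _)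
  · intro s hs r hr
    exact (hest s hs).2 _ (hest r hr).1
end
end
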